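/- Let Y be a finitely generated free P-module and let φ : Y × F₁ → F₄ be a P-bilinear map such that φ(y, d₂x₂) = 0 for all y ∈ Y and x₂ ∈ F₂. Then there exists a P-linear map φ̃ : Y → F₄ such that d₁(x₁)·φ̃(y) = φ(y, x₁) for all y ∈ Y and x₁ ∈ F₁. -/

import Mathlib

open QuadraticMap LinearMap Submodule Function

theorem stmt_8
    (P : Type*) [CommRing P] [IsNoetherianRing P]
    (F1 F2 F3 F4 : Type*)
    [AddCommGroup F1] [Module P F1] [Module.Free P F1] [Module.Finite P F1]
    [AddCommGroup F2] [Module P F2] [Module.Free P F2] [Module.Finite P F2]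
    [AddCommGroup F3] [Module P F3] [Module.Free P F3] [Module.Finite P F3]
    [AddCommGroup F4] [Module P F4] [Module.Free P F4] [Module.Finite P F4]
    (d1 : F1 →ₗ[P] P) (d2 : F2 →ₗ[P] F1) (d3 : F3 →ₗ[P] F2) (d4 : F4 →ₗ[P] F3)
    (hd21 : ∀ x2, d1 (d2 x2) = 0) (hd32 : ∀ x3, d2 (d3 x3) = 0)
    (hd43 : ∀ x4, d3 (d4 x4) = 0)
    (hinj4 : Function.Injective d4)
    (hex3 : LinearMap.range d4 = LinearMap.ker d3)
    (hex2 : LinearMap.range d3 = LinearMap.ker d2)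
    (hex1 : LinearMap.range d2 = LinearMap.ker d1)
    (hrank : Nonempty (F4 ≃ₗ[P] P))
    (ψ3 : F1 →ₗ[P] F3 →ₗ[P] F4) (ψ4 : QuadraticMap P F2 F4)
    (hA2 : ∀ x1 x4, ψ3 x1 (d4 x4) = d1 x1 • x4)
    (hA3 : ∀ x2 x3, polar ψ4 x2 (d3 x3) = - ψ3 (d2 x2) x3)
    (hiso1 : Function.Bijective ψ3)
    (hiso2 : Function.Bijective (polarBilin ψ4))
    (hiso3 : Function.Bijective ψ3.flip)
    (hreg : ∃ x1, d1 x1 ∈ nonZeroDivisors P)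
    (Y : Type*) [AddCommGroup Y] [Module P Y] [Module.Free P Y] [Module.Finite P Y]
    (φ : Y →ₗ[P] F1 →ₗ[P] F4)
    (hφ : ∀ y x2, φ y (d2 x2) = 0)
    : ∃ φt : Y →ₗ[P] F4, ∀ y x1, d1 x1 • φt y = φ y x1 := by
  let e3 := LinearEquiv.ofBijective ψ3.flip hiso3
  have he3 (y x1) : ψ3 x1 (e3.symm (φ y)) = φ y x1 :=
    LinearMap.congr_fun (e3.apply_symm_apply (φ y)) x1
  have hker (y) : d3 (e3.symm (φ y)) = 0 := by
    apply hiso2.injective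
    ext x2
    rw [map_zero, LinearMap.zero_apply, polarBilin_apply_apply, polar_comm, hA3, he3, hφ,
      neg_zero]
  have hrange (y) : (e3.symm.toLinearMap ∘ₗ φ) y ∈ LinearMap.range d4 := by
    rw [hex3]
    exact hker y
  let e4 := LinearEquiv.ofInjective d4 hinj4
  refine ⟨e4.symm.toLinearMap ∘ₗ (e3.symm.toLinearMap ∘ₗ φ).codRestrict _ hrange,
    fun y x1 => ?_⟩
  have he4 : d4 (e4.symm ⟨_, hrange y⟩) = e3.symm (φ y) :=
    congrArg Subtype.val (e4.apply_symm_apply ⟨_, hrange y⟩)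
  rw [← hA2, ← he3]
  exact congrArg (ψ3 x1) he4
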